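/- (Population version of the split bound.) Let ĥ, h̄, y*, y*_S, y*_T : X → Y be measurable classifiers with λ := ε_{μS}(y*, y*_S) + ε_{μT}(y*, y*_T), let D ⊆ X be a measurable overlap set, and suppose Δ(ĥ, y*) ≤ Δ(ĥ, h̄). Then ε_{μT}(ĥ, y*_T) ≤ ε_{μS}(ĥ, y*_S) + Δ(ĥ, h̄, D) + Δ̲(ĥ, h̄, D) + λ. -/

import Mathlib

open MeasureTheory

/-- Population disagreement between two classifiers under measure `μ`. -/
noncomputable def err {X Y : Type*} [MeasurableSpace X] (μ : Measure X) (h h' : X → Y) : ℝ :=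
  (μ {x | h x ≠ h' x}).toReal

/-- Disagreement restricted to a region `A`. -/
noncomputable def errOn {X Y : Type*} [MeasurableSpace X] (μ : Measure X) (A : Set X)
    (h h' : X → Y) : ℝ :=
  (μ {x | x ∈ A ∧ h x ≠ h' x}).toReal

/-- Disagreement discrepancy between target `μT` and source `μS`. -/
noncomputable def disc {X Y : Type*} [MeasurableSpace X] (μS μT : Measure X) (h h' : X → Y) : ℝ :=
  err μT h h' - err μS h h'

/-- Overlap-aware disagreement discrepancy (ODD), computed on the non-overlapping region. -/
noncomputable def oddDisc {X Y : Type*} [MeasurableSpace X] (μS μT : Measure X) (D : Set X)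
    (h h' : X → Y) : ℝ :=
  errOn μT Dᶜ h h' - errOn μS Dᶜ h h'

/-- Overlap discrepancy, computed on the overlap region `D`. -/
noncomputable def ovDisc {X Y : Type*} [MeasurableSpace X] (μS μT : Measure X) (D : Set X)
    (h h' : X → Y) : ℝ :=
  errOn μT D h h' - errOn μS D h h'

lemma err_tri {X Y : Type*} [MeasurableSpace X] (μ : Measure X) [IsProbabilityMeasure μ]
    (a b c : X → Y) : err μ a c ≤ err μ a b + err μ b c := by
  have h : {x | a x ≠ c x} ⊆ {x | a x ≠ b x} ∪ {x | b x ≠ c x} := by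
    intro x hx
    by_cases hab : a x = b x
    · right
      exact fun hbc => hx (hab.trans hbc)
    · left
      exact hab
  exact (measureReal_mono (μ := μ) h).trans (measureReal_union_le _ _)

lemma err_comm {X Y : Type*} [MeasurableSpace X] (μ : Measure X)
    (a b : X → Y) : err μ a b = err μ b a := by
  simp only [err, ne_comm]

lemma err_split {X Y : Type*} [MeasurableSpace X] (μ : Measure X) [IsProbabilityMeasure μ]
    (D : Set X) (mD : MeasurableSet D) (a b : X → Y) :
    err μ a b = errOn μ D a b + errOn μ Dᶜ a b := by
  have h := measureReal_inter_add_sdiff (μ := μ) (s := {x | a x ≠ b x}) mD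
  have h1 : {x | a x ≠ b x} ∩ D = {x | x ∈ D ∧ a x ≠ b x} := by
    ext x
    exact and_comm
  have h2 : {x | a x ≠ b x} \ D = {x | x ∈ Dᶜ ∧ a x ≠ b x} := by
    ext x
    exact and_comm
  rw [h1, h2] at h
  exact h.symm

/-- Population version of the split bound: if `Δ(ĥ, y*) ≤ Δ(ĥ, h̄)`, then
`ε_{μT}(ĥ, y*_T) ≤ ε_{μS}(ĥ, y*_S) + Δ(ĥ, h̄, D) + Δ̲(ĥ, h̄, D) + λ`. -/
theorem split_bound_population {X Y : Type*} [MeasurableSpace X] [MeasurableSpace Y]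
    [MeasurableSingletonClass Y] [Fintype Y] [Nonempty Y] [DecidableEq Y]
    (μS μT : Measure X) [IsProbabilityMeasure μS] [IsProbabilityMeasure μT]
    (hhat hbar ystar yS yT : X → Y)
    (mhat : Measurable hhat) (mbar : Measurable hbar) (mstar : Measurable ystar)
    (mS : Measurable yS) (mT : Measurable yT)
    (D : Set X) (mD : MeasurableSet D)
    (hcritic : disc μS μT hhat ystar ≤ disc μS μT hhat hbar) :
    err μT hhat yT ≤
      err μS hhat yS + oddDisc μS μT D hhat hbar + ovDisc μS μT D hhat hbar +
        (err μS ystar yS + err μT ystar yT) := by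
  have h1 := err_tri μT hhat ystar yT
  have h2 := err_tri μS hhat yS ystar
  rw [err_comm μS yS ystar] at h2
  have h3 := err_split μT D mD hhat hbar
  have h4 := err_split μS D mD hhat hbar
  unfold disc at hcritic
  unfold oddDisc ovDisc
  linarith
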